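/- arXiv:1102.5434 — 2 statements merged into one kernel-verified Lean document; each statement's English description precedes it below -/
import Mathlib

section
/- Let k ≥ 2. Every f ∈ M with Dᵏ f = 0 can be written uniquely as f = g + x^{k−1} h with g ∈ ker(D^{k−1}) and h ∈ ker D; that is, ker(Dᵏ) = ker(D^{k−1}) ⊕ x^{k−1}(ker D). Moreover the components are given explicitly by h = Q_{k−1}(D^{k−1} f) and g = f − x^{k−1} Q_{k−1}(D^{k−1} f). -/
/-- The operator `U_s`: `U_{2k} = k·id` and `U_{2k+1} = E + (n/2 + k)·id`. -/
noncomputable def Uop {M : Type*} [AddCommGroup M] [Module ℝ M]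
    (n : ℕ) (E : Module.End ℝ M) (s : ℕ) : Module.End ℝ M :=
  if s % 2 = 0 then ((s / 2 : ℕ) : ℝ) • (1 : Module.End ℝ M)
  else E + (((n : ℝ) / 2) + ((s / 2 : ℕ) : ℝ)) • (1 : Module.End ℝ M)

/-- The inverse `(U_s)⁻¹`: `(U_{2j})⁻¹ = (1/j)·id` and `(U_{2j+1})⁻¹ = I_j`. -/
noncomputable def UopInv {M : Type*} [AddCommGroup M] [Module ℝ M]
    (I : ℕ → Module.End ℝ M) (s : ℕ) : Module.End ℝ M :=
  if s % 2 = 0 then ((1 : ℝ) / ((s / 2 : ℕ) : ℝ)) • (1 : Module.End ℝ M)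
  else I (s / 2)

/-- The operator `Q_k = (−1/2)ᵏ (U_k)⁻¹∘(U_{k−1})⁻¹∘⋯∘(U_1)⁻¹`. -/
noncomputable def Qop {M : Type*} [AddCommGroup M] [Module ℝ M]
    (I : ℕ → Module.End ℝ M) : ℕ → Module.End ℝ M
  | 0 => 1
  | k + 1 => ((-1 : ℝ) / 2) • (UopInv I (k + 1) * Qop I k)

section Almansi

variable {M : Type*} [AddCommGroup M] [Module ℝ M]

/-- The scaled product `(-2)ᵏ U_1 ∘ ⋯ ∘ U_k`, by which `Dᵏ xᵏ` acts on `ker D`. -/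
noncomputable def Pop (n : ℕ) (E : Module.End ℝ M) : ℕ → Module.End ℝ M
  | 0 => 1
  | k + 1 => (-2 : ℝ) • (Pop n E k * Uop n E (k + 1))

theorem Uop_add_two (n : ℕ) (E : Module.End ℝ M) (s : ℕ) :
    Uop n E (s + 2) = Uop n E s + 1 := by
  have h : (s + 2) / 2 = s / 2 + 1 := by omega
  unfold Uop
  rw [Nat.add_mod_right, h]
  split_ifs
  · push_cast
    module
  · push_cast
    module

theorem Uop_mul_UopInv {n : ℕ} {E : Module.End ℝ M} {I : ℕ → Module.End ℝ M}
    (hI : ∀ j : ℕ,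
      (E + (((n : ℝ) / 2) + (j : ℝ)) • (1 : Module.End ℝ M)) * I j = 1 ∧
      I j * (E + (((n : ℝ) / 2) + (j : ℝ)) • (1 : Module.End ℝ M)) = 1) (s : ℕ) :
    Uop n E (s + 1) * UopInv I (s + 1) = 1 ∧ UopInv I (s + 1) * Uop n E (s + 1) = 1 := by
  unfold Uop UopInv
  split_ifs with h
  · have h0 : (((s + 1) / 2 : ℕ) : ℝ) ≠ 0 := by
      have : (s + 1) / 2 ≠ 0 := by omega
      exact_mod_cast this
    constructor <;> rw [smul_mul_smul_comm, mul_one] <;> simp [h0]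
  · exact hI _

theorem Pop_mul_Qop {n : ℕ} {E : Module.End ℝ M} {I : ℕ → Module.End ℝ M}
    (hI : ∀ j : ℕ,
      (E + (((n : ℝ) / 2) + (j : ℝ)) • (1 : Module.End ℝ M)) * I j = 1 ∧
      I j * (E + (((n : ℝ) / 2) + (j : ℝ)) • (1 : Module.End ℝ M)) = 1) (s : ℕ) :
    Pop n E s * Qop I s = 1 ∧ Qop I s * Pop n E s = 1 := by
  induction s with
  | zero => simp [Pop, Qop]
  | succ s ih =>
    obtain ⟨h₁, h₂⟩ := Uop_mul_UopInv hI s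
    constructor
    · rw [Pop, Qop, smul_mul_smul_comm, mul_assoc, ← mul_assoc (Uop n E _), h₁, one_mul, ih.1]
      norm_num
    · rw [Pop, Qop, smul_mul_smul_comm, mul_assoc, ← mul_assoc (Qop I s), ih.2, one_mul, h₂]
      norm_num

/-- `U_s` maps `ker D` to itself. -/
theorem Uop_mem_ker {n : ℕ} {D E : Module.End ℝ M} (hED : E * D - D * E = -D) (s : ℕ)
    {h : M} (hh : D h = 0) : D (Uop n E s h) = 0 := by
  have hE : D (E h) = 0 := by simpa [hh] using LinearMap.congr_fun hED h
  unfold Uop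
  split_ifs <;> simp [hh, hE]

theorem UopInv_mem_ker {n : ℕ} {D E : Module.End ℝ M} {I : ℕ → Module.End ℝ M}
    (hED : E * D - D * E = -D)
    (hI : ∀ j : ℕ,
      (E + (((n : ℝ) / 2) + (j : ℝ)) • (1 : Module.End ℝ M)) * I j = 1 ∧
      I j * (E + (((n : ℝ) / 2) + (j : ℝ)) • (1 : Module.End ℝ M)) = 1) (s : ℕ)
    {h : M} (hh : D h = 0) : D (UopInv I s h) = 0 := by
  unfold UopInv
  split_ifs
  · simp [hh]
  · generalize s / 2 = j
    have hcomm : (E + (((n : ℝ) / 2) + ((j + 1 : ℕ) : ℝ)) • (1 : Module.End ℝ M)) * D =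
        D * (E + (((n : ℝ) / 2) + (j : ℝ)) • (1 : Module.End ℝ M)) := by
      rw [add_mul, mul_add, smul_mul_assoc, mul_smul_comm, one_mul, mul_one,
        sub_eq_iff_eq_add.mp hED]
      push_cast
      module
    have key : D * I j = I (j + 1) * D := by
      calc D * I j = I (j + 1) * ((E + (((n : ℝ) / 2) + ((j + 1 : ℕ) : ℝ)) •
            (1 : Module.End ℝ M)) * D) * I j := by
              rw [← mul_assoc (I (j + 1)), (hI (j + 1)).2, one_mul]
        _ = I (j + 1) * D := by
              rw [hcomm, mul_assoc, mul_assoc, (hI j).1, mul_one]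
    simpa [hh] using LinearMap.congr_fun key h

theorem Qop_mem_ker {n : ℕ} {D E : Module.End ℝ M} {I : ℕ → Module.End ℝ M}
    (hED : E * D - D * E = -D)
    (hI : ∀ j : ℕ,
      (E + (((n : ℝ) / 2) + (j : ℝ)) • (1 : Module.End ℝ M)) * I j = 1 ∧
      I j * (E + (((n : ℝ) / 2) + (j : ℝ)) • (1 : Module.End ℝ M)) = 1) (s : ℕ)
    {h : M} (hh : D h = 0) : D (Qop I s h) = 0 := by
  induction s with
  | zero => simpa [Qop] using hh
  | succ s ih => simp [Qop, UopInv_mem_ker hED hI (s + 1) ih]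

/-- `D x^{s+1} h = -2 x^s U_{s+1} h` for `h ∈ ker D`. -/
theorem D_x_pow_succ {n : ℕ} {x D E : Module.End ℝ M}
    (hxD : x * D + D * x = (-2 : ℝ) • E - (n : ℝ) • (1 : Module.End ℝ M))
    (hEx : E * x - x * E = x) {h : M} (hh : D h = 0) (s : ℕ) :
    D ((x ^ (s + 1)) h) = (-2 : ℝ) • (x ^ s) (Uop n E (s + 1) h) := by
  have hDx (y : M) : D (x y) = (-2 : ℝ) • E y - (n : ℝ) • y - x (D y) := by
    have := LinearMap.congr_fun hxD y
    simp only [LinearMap.add_apply, Module.End.mul_apply, LinearMap.sub_apply,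
      LinearMap.smul_apply, Module.End.one_apply] at this
    rw [← this]
    abel
  have hE (y : M) : E (x y) = x y + x (E y) := by
    have := LinearMap.congr_fun hEx y
    simp only [Module.End.mul_apply, LinearMap.sub_apply] at this
    exact sub_eq_iff_eq_add.mp this
  have hDxx (y : M) : D (x (x y)) = x (x (D y)) - (2 : ℝ) • x y := by
    rw [hDx, hDx, hE]
    simp only [map_sub, map_smul]
    module
  induction s using Nat.twoStepInduction with
  | zero =>
    simp only [zero_add, pow_one, pow_zero, Module.End.one_apply, hDx, hh, map_zero]
    simp only [Uop, Nat.reduceMod, one_ne_zero, if_false, Nat.reduceDiv, Nat.cast_zero,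
      LinearMap.add_apply, LinearMap.smul_apply, Module.End.one_apply]
    module
  | one =>
    have : (x ^ (1 + 1)) h = x (x h) := by rw [pow_succ, pow_one, Module.End.mul_apply]
    rw [this, hDxx, hh]
    simp [Uop]
  | more s ih _ =>
    have h₁ (t : ℕ) (y : M) : (x ^ (t + 2)) y = x (x ((x ^ t) y)) := by
      rw [pow_succ', pow_succ', Module.End.mul_apply, Module.End.mul_apply]
    have h₂ : (x ^ (s + 2 + 1)) h = x (x ((x ^ (s + 1)) h)) := h₁ (s + 1) h
    have h₃ : x ((x ^ (s + 1)) h) = x (x ((x ^ s) h)) := by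
      rw [pow_succ', Module.End.mul_apply]
    have h₄ : Uop n E (s + 2 + 1) = Uop n E (s + 1) + 1 := Uop_add_two n E (s + 1)
    rw [h₂, hDxx, ih, h₁, h₃, h₄]
    simp only [LinearMap.add_apply, Module.End.one_apply, map_add, map_smul]
    module

/-- `Dˢ xˢ` acts on `ker D` as `(-2)ˢ U_1 ∘ ⋯ ∘ U_s`. -/
theorem D_pow_x_pow {n : ℕ} {x D E : Module.End ℝ M}
    (hxD : x * D + D * x = (-2 : ℝ) • E - (n : ℝ) • (1 : Module.End ℝ M))
    (hEx : E * x - x * E = x) (hED : E * D - D * E = -D) (s : ℕ) {h : M} (hh : D h = 0) :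
    (D ^ s) ((x ^ s) h) = Pop n E s h := by
  induction s generalizing h with
  | zero => simp [Pop]
  | succ s ih =>
    rw [pow_succ D, Module.End.mul_apply, D_x_pow_succ hxD hEx hh, map_smul,
      ih (Uop_mem_ker hED _ hh)]
    rfl

end Almansi

/-- for `k ≥ 2`, every `f ∈ ker(Dᵏ)` decomposes uniquely as
`f = g + x^{k−1} h` with `g ∈ ker(D^{k−1})` and `h ∈ ker D`; the components are given
by `h = Q_{k−1}(D^{k−1} f)` and `g = f − x^{k−1} Q_{k−1}(D^{k−1} f)`. -/
theorem almansi_step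
    {M : Type*} [AddCommGroup M] [Module ℝ M] (n : ℕ) (hn : 0 < n)
    (x D E : Module.End ℝ M) (I : ℕ → Module.End ℝ M)
    (hxD : x * D + D * x = (-2 : ℝ) • E - (n : ℝ) • (1 : Module.End ℝ M))
    (hEx : E * x - x * E = x)
    (hED : E * D - D * E = -D)
    (hI : ∀ j : ℕ,
      (E + (((n : ℝ) / 2) + (j : ℝ)) • (1 : Module.End ℝ M)) * I j = 1 ∧
      I j * (E + (((n : ℝ) / 2) + (j : ℝ)) • (1 : Module.End ℝ M)) = 1)
    (k : ℕ) (hk : 2 ≤ k) :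
    ∀ f : M, (D ^ k) f = 0 →
      D ((Qop I (k - 1)) ((D ^ (k - 1)) f)) = 0 ∧
      (D ^ (k - 1)) (f - (x ^ (k - 1)) ((Qop I (k - 1)) ((D ^ (k - 1)) f))) = 0 ∧
      f = (f - (x ^ (k - 1)) ((Qop I (k - 1)) ((D ^ (k - 1)) f))) +
            (x ^ (k - 1)) ((Qop I (k - 1)) ((D ^ (k - 1)) f)) ∧
      (∀ g h : M, (D ^ (k - 1)) g = 0 → D h = 0 → f = g + (x ^ (k - 1)) h →
        h = (Qop I (k - 1)) ((D ^ (k - 1)) f) ∧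
        g = f - (x ^ (k - 1)) ((Qop I (k - 1)) ((D ^ (k - 1)) f))) := by
  obtain ⟨s, rfl⟩ : ∃ s, k = s + 1 := ⟨k - 1, by omega⟩
  rw [Nat.add_sub_cancel]
  intro f hf
  obtain ⟨hPQ, hQP⟩ := Pop_mul_Qop hI s
  have hDf : D ((D ^ s) f) = 0 := by rwa [pow_succ', Module.End.mul_apply] at hf
  have hQ := Qop_mem_ker hED hI s hDf
  refine ⟨hQ, ?_, (sub_add_cancel _ _).symm, ?_⟩
  · rw [map_sub, D_pow_x_pow hxD hEx hED s hQ, ← Module.End.mul_apply, hPQ,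
      Module.End.one_apply, sub_self]
  · intro g h hg hh hfg
    have hh' : h = Qop I s ((D ^ s) f) := by
      rw [hfg, map_add, hg, zero_add, D_pow_x_pow hxD hEx hED s hh, ← Module.End.mul_apply, hQP,
        Module.End.one_apply]
    refine ⟨hh', ?_⟩
    rw [← hh']
    exact eq_sub_of_add_eq hfg.symm
end

section
/- Let A be an ℝ-linear endomorphism of M and a ∈ ℝ with A∘D − D∘A = a·D. Then: (i) for every k ∈ ℕ one has the operator identity Dᵏ∘A = (A − k a·id)∘Dᵏ; and (ii) if moreover R is an ℝ-linear endomorphism of M with Dᵏ(R f) = 0 for every f ∈ ker D, then for every f ∈ ker D one has Dᵏ((A∘xᵏ)(f) + R(f)) = (−2)ᵏ (A − k a·id)(U₁(U₂(⋯(U_k f)))). -/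
section Umbral

variable {M : Type*} [AddCommGroup M] [Module ℝ M]

theorem Uop_zero (n : ℕ) (E : Module.End ℝ M) : Uop n E 0 = 0 := by
  simp [Uop]

theorem Uop_succ_add_Uop (n : ℕ) (E : Module.End ℝ M) (s : ℕ) :
    Uop n E (s + 1) + Uop n E s = E + ((n : ℝ) / 2 + s) • (1 : Module.End ℝ M) := by
  rcases Nat.even_or_odd' s with ⟨j, rfl | rfl⟩
  · have h1 : (2 * j + 1) % 2 = 1 := by omega
    have h2 : (2 * j + 1) / 2 = j := by omega
    have h3 : 2 * j / 2 = j := by omega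
    simp only [Uop, h1, h2, h3, Nat.mul_mod_right, one_ne_zero, if_true, if_false]
    push_cast
    module
  · have h1 : (2 * j + 1) % 2 = 1 := by omega
    have h2 : (2 * j + 1) / 2 = j := by omega
    have h3 : (2 * j + 1 + 1) % 2 = 0 := by omega
    have h4 : (2 * j + 1 + 1) / 2 = j + 1 := by omega
    simp only [Uop, h1, h2, h3, h4, one_ne_zero, if_true, if_false]
    push_cast
    module

theorem Uop_apply_mem_ker {n : ℕ} {D E : Module.End ℝ M} (hED : E * D - D * E = -D)
    (s : ℕ) {f : M} (hf : D f = 0) : D (Uop n E s f) = 0 := by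
  have hE : D (E f) = 0 := by
    have h := LinearMap.congr_fun hED f
    simpa [hf] using h
  unfold Uop
  split_ifs <;> simp [hf, hE]

theorem euler_pow_apply {x E : Module.End ℝ M} (hEx : E * x - x * E = x) (s : ℕ) (f : M) :
    E ((x ^ s) f) = (x ^ s) (E f + (s : ℝ) • f) := by
  induction s with
  | zero => simp
  | succ s ih =>
    have h : ∀ g, E (x g) = x (E g) + x g := fun g => by
      have h := LinearMap.congr_fun hEx g
      simp only [LinearMap.sub_apply, Module.End.mul_apply] at h
      exact sub_eq_iff_eq_add'.mp h
    simp only [pow_succ', Module.End.mul_apply, h, ih, map_add, map_smul]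
    push_cast
    module

theorem dirac_pow_succ_apply {n : ℕ} {x D E : Module.End ℝ M}
    (hxD : x * D + D * x = (-2 : ℝ) • E - (n : ℝ) • (1 : Module.End ℝ M))
    (hEx : E * x - x * E = x) (s : ℕ) {f : M} (hf : D f = 0) :
    D ((x ^ (s + 1)) f) = (-2 : ℝ) • (x ^ s) (Uop n E (s + 1) f) := by
  have hDx : ∀ g, D (x g) = (-2 : ℝ) • E g - (n : ℝ) • g - x (D g) := fun g => by
    have h := LinearMap.congr_fun hxD g
    simp only [LinearMap.add_apply, LinearMap.sub_apply, LinearMap.smul_apply,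
      Module.End.mul_apply, Module.End.one_apply] at h
    exact eq_sub_of_add_eq' h
  have hU : ∀ s, Uop n E (s + 1) f = E f + ((n : ℝ) / 2 + s) • f - Uop n E s f := fun s => by
    have h := LinearMap.congr_fun (Uop_succ_add_Uop n E s) f
    simp only [LinearMap.add_apply, LinearMap.smul_apply, Module.End.one_apply] at h
    exact eq_sub_of_add_eq h
  induction s with
  | zero =>
    rw [hU, Uop_zero]
    simp only [zero_add, pow_one, pow_zero, hDx, hf, Module.End.one_apply, LinearMap.zero_apply,
      map_zero]
    push_cast
    module
  | succ s ih =>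
    rw [pow_succ', Module.End.mul_apply, hDx, ih, euler_pow_apply hEx, hU (s + 1), map_smul,
      ← Module.End.mul_apply x, ← pow_succ']
    simp only [map_add, map_sub, map_smul]
    module

theorem dirac_pow_pow_apply {n : ℕ} {x D E : Module.End ℝ M}
    (hxD : x * D + D * x = (-2 : ℝ) • E - (n : ℝ) • (1 : Module.End ℝ M))
    (hEx : E * x - x * E = x) (hED : E * D - D * E = -D) (k : ℕ) {f : M} (hf : D f = 0) :
    (D ^ k) ((x ^ k) f) =
      (-2 : ℝ) ^ k • ((List.range k).map (fun i => Uop n E (i + 1))).prod f := by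
  induction k generalizing f with
  | zero => simp
  | succ k ih =>
    rw [pow_succ D, Module.End.mul_apply, dirac_pow_succ_apply hxD hEx k hf, map_smul,
      ih (Uop_apply_mem_ker hED _ hf), smul_smul, ← pow_succ', List.range_succ]
    simp

theorem pow_mul_of_commutator_eq_smul {D A : Module.End ℝ M} {a : ℝ}
    (hA : A * D - D * A = a • D) (k : ℕ) :
    D ^ k * A = (A - ((k : ℝ) * a) • (1 : Module.End ℝ M)) * D ^ k := by
  induction k with
  | zero => simp
  | succ k ih =>
    have h : D * A = A * D - a • D := by rw [← hA]; abel
    rw [pow_succ', mul_assoc, ih, ← mul_assoc, mul_sub, h, ← mul_assoc]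
    simp only [sub_mul, mul_smul_comm, smul_mul_assoc, mul_one, one_mul, mul_assoc]
    push_cast
    module

end Umbral

/-- if `A∘D − D∘A = a·D` then (i) `Dᵏ∘A = (A − ka·id)∘Dᵏ` for all `k`, and
(ii) if `Dᵏ∘R` vanishes on `ker D` then for `f ∈ ker D` one has
`Dᵏ((A∘xᵏ)f + Rf) = (−2)ᵏ (A − ka·id)(U₁(U₂(⋯(U_k f))))`. -/
theorem commutator_iterated_dirac
    {M : Type*} [AddCommGroup M] [Module ℝ M] (n : ℕ) (hn : 0 < n)
    (x D E : Module.End ℝ M)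
    (hxD : x * D + D * x = (-2 : ℝ) • E - (n : ℝ) • (1 : Module.End ℝ M))
    (hEx : E * x - x * E = x)
    (hED : E * D - D * E = -D)
    (A : Module.End ℝ M) (a : ℝ) (hA : A * D - D * A = a • D) :
    (∀ k : ℕ, D ^ k * A = (A - ((k : ℝ) * a) • (1 : Module.End ℝ M)) * D ^ k) ∧
    (∀ k : ℕ, ∀ R : Module.End ℝ M, (∀ f : M, D f = 0 → (D ^ k) (R f) = 0) →
      ∀ f : M, D f = 0 →
        (D ^ k) ((A * x ^ k) f + R f) =
          ((-2 : ℝ)) ^ k •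
            ((A - ((k : ℝ) * a) • (1 : Module.End ℝ M))
              ((((List.range k).map (fun i => Uop n E (i + 1))).prod) f))) := by
  refine ⟨pow_mul_of_commutator_eq_smul hA, fun k R hR f hf => ?_⟩
  have h := LinearMap.congr_fun (pow_mul_of_commutator_eq_smul hA k) ((x ^ k) f)
  rw [Module.End.mul_apply, Module.End.mul_apply, dirac_pow_pow_apply hxD hEx hED k hf,
    map_smul] at h
  rw [map_add, hR f hf, add_zero, Module.End.mul_apply, h]
end
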